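/- Suppose U is a Gorenstein bimodule and the injective dimension of U as a right Γ-module and as a left Λ-module both equal g. Then the assignment M ↦ Ext^g_Λ(M,U) gives a duality between H_g(mod Λ) and H_g(mod Γ^op): for M in H_g(mod Λ), Ext^g_Λ(M,U) lies in H_g(mod Γ^op), dually for N in H_g(mod Γ^op), Ext^g_Γ(N,U) lies in H_g(mod Λ), and M ≅ Ext^g_Γ(Ext^g_Λ(M,U),U) and N ≅ Ext^g_Λ(Ext^g_Γ(N,U),U). -/

import Mathlib

/-! Common definitions: concrete Ext groups (via the canonical free resolution) of a module
over a ring `R` with coefficients in an `(R,S)`-bimodule `U`, carrying their natural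
`S`-module structure; grades, Gorenstein conditions, resolution dimensions, etc. -/

noncomputable section

namespace GorPaper

section Ext

variable (R : Type) [Ring R]

/-- The canonical free cover `R^(M) → M` of a module. -/
def cover (M : Type) [AddCommGroup M] [Module R M] : (M →₀ R) →ₗ[R] M :=
  Finsupp.linearCombination R (_root_.id : M → M)

/-- The syzygy modules of `M` along its canonical free resolution:
`syz R M 0 = M` and `syz R M (n+1) = ker (R^(syz R M n) → syz R M n)`. -/
def syz (M : ModuleCat.{0} R) : ℕ → ModuleCat.{0} R
  | 0 => M
  | n + 1 => ModuleCat.of R (LinearMap.ker (cover R (syz M n)))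

variable {R} in
/-- Functoriality of the free cover. -/
def freeMap {M N : Type} [AddCommGroup M] [Module R M] [AddCommGroup N] [Module R N]
    (f : M →ₗ[R] N) : (M →₀ R) →ₗ[R] (N →₀ R) :=
  Finsupp.lmapDomain R R f

lemma cover_comp_freeMap {M N : Type} [AddCommGroup M] [Module R M] [AddCommGroup N]
    [Module R N] (f : M →ₗ[R] N) : (cover R N).comp (freeMap f) = f.comp (cover R M) := by
  ext a
  simp [cover, freeMap, Finsupp.linearCombination_single]

lemma freeMap_ker {M N : Type} [AddCommGroup M] [Module R M] [AddCommGroup N] [Module R N]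
    (f : M →ₗ[R] N) :
    ∀ x ∈ LinearMap.ker (cover R M), freeMap f x ∈ LinearMap.ker (cover R N) := by
  intro x hx
  have := congrArg (fun g => g x) (cover_comp_freeMap R f)
  simp only [LinearMap.comp_apply] at this
  simp only [LinearMap.mem_ker] at hx ⊢
  rw [this, hx, map_zero]

variable {R} in
/-- The induced map on first syzygies. -/
def kerMap {M N : Type} [AddCommGroup M] [Module R M] [AddCommGroup N] [Module R N]
    (f : M →ₗ[R] N) :
    ↥(LinearMap.ker (cover R M)) →ₗ[R] ↥(LinearMap.ker (cover R N)) :=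
  (freeMap f).restrict (freeMap_ker R f)

variable {R} in
/-- The induced map on `n`-th syzygies. -/
def syzMap {M N : ModuleCat.{0} R} (f : ↥M →ₗ[R] ↥N) :
    ∀ n, ↥(syz R M n) →ₗ[R] ↥(syz R N n)
  | 0 => f
  | n + 1 => kerMap (syzMap f n)

variable (S : Type) [Ring S]
variable (U : Type) [AddCommGroup U] [Module R U] [Module S U] [SMulCommClass R S U]

/-- Precomposition `Hom_R(B,U) → Hom_R(A,U)`, as an `S`-linear map (where the `S`-module
structures come from the right `S`-structure of the bimodule `U`). -/
def precompS {A B : Type} [AddCommMonoid A] [Module R A] [AddCommMonoid B] [Module R B]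
    (t : A →ₗ[R] B) : (B →ₗ[R] U) →ₗ[S] (A →ₗ[R] U) where
  toFun g := g.comp t
  map_add' g h := LinearMap.add_comp _ _ _
  map_smul' s g := LinearMap.smul_comp _ _ _

/-- The submodule of `Hom_R(Ω N, U)` consisting of those homomorphisms which extend to
the free cover of `N`. -/
def ext1Sub (N : Type) [AddCommGroup N] [Module R N] :
    Submodule S (↥(LinearMap.ker (cover R N)) →ₗ[R] U) :=
  LinearMap.range (precompS R S U (LinearMap.ker (cover R N)).subtype)

/-- `Ext¹_R(N, U)`, as an `S`-module. -/
def Ext1 (N : Type) [AddCommGroup N] [Module R N] : Type :=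
  (↥(LinearMap.ker (cover R N)) →ₗ[R] U) ⧸ ext1Sub R S U N

instance (N : Type) [AddCommGroup N] [Module R N] : AddCommGroup (Ext1 R S U N) :=
  inferInstanceAs (AddCommGroup (_ ⧸ ext1Sub R S U N))

instance (N : Type) [AddCommGroup N] [Module R N] : Module S (Ext1 R S U N) :=
  inferInstanceAs (Module S (_ ⧸ ext1Sub R S U N))

/-- `Ext^n_R(M, U)`, as an `S`-module: `Ext⁰ = Hom_R(M,U)` and
`Ext^{n+1}(M,U) = Ext¹(Ω^n M, U)` (dimension shifting along the canonical free
resolution of `M`). -/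
def ExtU (M : ModuleCat.{0} R) : ℕ → Type
  | 0 => ↥M →ₗ[R] U
  | n + 1 => Ext1 R S U ↥(syz R M n)

instance (M : ModuleCat.{0} R) (n : ℕ) : AddCommGroup (ExtU R S U M n) :=
  match n with
  | 0 => inferInstanceAs (AddCommGroup (↥M →ₗ[R] U))
  | n + 1 => inferInstanceAs (AddCommGroup (Ext1 R S U ↥(syz R M n)))

instance (M : ModuleCat.{0} R) (n : ℕ) : Module S (ExtU R S U M n) :=
  match n with
  | 0 => inferInstanceAs (Module S (↥M →ₗ[R] U))
  | n + 1 => inferInstanceAs (Module S (Ext1 R S U ↥(syz R M n)))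

lemma ext1Sub_le_comap {M N : Type} [AddCommGroup M] [Module R M] [AddCommGroup N]
    [Module R N] (f : M →ₗ[R] N) :
    ext1Sub R S U N ≤ (ext1Sub R S U M).comap (precompS R S U (kerMap f)) := by
  rintro g ⟨h, rfl⟩
  exact ⟨precompS R S U (freeMap f) h, LinearMap.ext fun x => rfl⟩

variable {R} in
/-- Contravariant functoriality of `Ext¹`. -/
def ext1Map {M N : Type} [AddCommGroup M] [Module R M] [AddCommGroup N] [Module R N]
    (f : M →ₗ[R] N) : Ext1 R S U N →ₗ[S] Ext1 R S U M :=
  Submodule.mapQ _ _ (precompS R S U (kerMap f)) (ext1Sub_le_comap R S U f)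

variable {R} in
/-- Contravariant functoriality of `Ext^n`: the map
`Ext^n_R(N,U) → Ext^n_R(M,U)` induced by `f : M → N`; it is `S`-linear. -/
def extMap {M N : ModuleCat.{0} R} (f : ↥M →ₗ[R] ↥N) :
    ∀ n, ExtU R S U N n →ₗ[S] ExtU R S U M n
  | 0 => precompS R S U f
  | n + 1 => ext1Map S U (syzMap f n)

/-- `Ext^n_R(M,U) = 0`. -/
def extVanish (M : ModuleCat.{0} R) (n : ℕ) : Prop :=
  Subsingleton (ExtU R S U M n)

/-- `grade_U M ≥ i` : `Ext^j_R(M,U) = 0` for all `j < i`. -/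
def gradeGE (M : ModuleCat.{0} R) (i : ℕ) : Prop :=
  ∀ j < i, extVanish R S U M j

/-- `grade_U M = g` : `grade_U M ≥ g` and `Ext^g_R(M,U) ≠ 0`. -/
def gradeEq (M : ModuleCat.{0} R) (g : ℕ) : Prop :=
  gradeGE R S U M g ∧ ¬ extVanish R S U M g

/-- `s.grade_U M ≥ i` : `grade_U B ≥ i` for every submodule `B` of `M`. -/
def sgradeGE (M : ModuleCat.{0} R) (i : ℕ) : Prop :=
  ∀ B : Submodule R ↥M, gradeGE R S U (ModuleCat.of R ↥B) i

/-- Membership in `H_g` : `grade_U M = g` and `Ext^i(M,U) = 0` for all `i ≠ g`. -/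
def Hmem (M : ModuleCat.{0} R) (g : ℕ) : Prop :=
  gradeEq R S U M g ∧ ∀ i, i ≠ g → extVanish R S U M i

/-- The functor `Ext^i_S(Ext^i_R(-,U),U) : mod R → mod R` preserves monomorphisms
(on finitely generated modules). -/
def ExtExtMono [SMulCommClass S R U] (i : ℕ) : Prop :=
  ∀ (X Y : ModuleCat.{0} R), Module.Finite R ↥X → Module.Finite R ↥Y →
    ∀ f : ↥X →ₗ[R] ↥Y, Function.Injective f →
      Function.Injective
        (extMap (R := S) (S := R) U
          (M := ModuleCat.of S (ExtU R S U Y i)) (N := ModuleCat.of S (ExtU R S U X i))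
          (extMap (S := S) U f i) i)

/-- `M` is `U`-`k`-torsionfree: for (every) finitely generated projective presentation
`P₁ → P₀ → M → 0`, with `X = coker (Hom(P₀,U) → Hom(P₁,U))`, one has
`Ext^i_S(X, U) = 0` for `1 ≤ i ≤ k`. -/
def Torsionfree [SMulCommClass S R U] (k : ℕ) (M : ModuleCat.{0} R) : Prop :=
  ∀ (P₁ P₀ : ModuleCat.{0} R), Module.Finite R ↥P₁ → Module.Projective R ↥P₁ →
    Module.Finite R ↥P₀ → Module.Projective R ↥P₀ →
    ∀ (f : ↥P₁ →ₗ[R] ↥P₀) (g : ↥P₀ →ₗ[R] ↥M), Function.Surjective g →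
      LinearMap.range f = LinearMap.ker g →
      ∀ i, 1 ≤ i → i ≤ k →
        extVanish S R U
          (ModuleCat.of S ((↥P₁ →ₗ[R] U) ⧸ LinearMap.range (precompS R S U f))) i

end Ext

section Resol

variable (R : Type) [Ring R] (U : Type) [AddCommGroup U] [Module R U]

/-- `A` belongs to `add U`: it is (isomorphic to) a direct summand of a finite direct
sum of copies of `U`. -/
def InAdd (A : ModuleCat.{0} R) : Prop :=
  ∃ (m : ℕ) (i : ↥A →ₗ[R] (Fin m → U)) (p : (Fin m → U) →ₗ[R] ↥A),
    p.comp i = LinearMap.id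

/-- `U`-resolution dimension of `A` is at most `n` : there is an exact sequence
`0 → U_n → ⋯ → U_0 → A → 0` with all `U_i` in `add U`. -/
def URdimLE : ℕ → ModuleCat.{0} R → Prop
  | 0, A => InAdd R U A
  | n + 1, A => ∃ V : ModuleCat.{0} R, InAdd R U V ∧
      ∃ g : ↥V →ₗ[R] ↥A, Function.Surjective g ∧
        URdimLE n (ModuleCat.of R ↥(LinearMap.ker g))

/-- The `U`-resolution dimension of `A`, as an element of `ℕ∞`. -/
def URdim (A : ModuleCat.{0} R) : ℕ∞ :=
  sInf {c : ℕ∞ | ∃ n : ℕ, c = n ∧ URdimLE R U n A}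

/-- `M` is a `k`-syzygy module: there is an exact sequence
`0 → M → P_{k-1} → ⋯ → P_0 → X → 0` with all `P_i` finitely generated projective. -/
def IsSyzygy : ℕ → ModuleCat.{0} R → Prop
  | 0, _ => True
  | k + 1, M => ∃ P : ModuleCat.{0} R, Module.Finite R ↥P ∧ Module.Projective R ↥P ∧
      ∃ f : ↥M →ₗ[R] ↥P, Function.Injective f ∧
        IsSyzygy k (ModuleCat.of R (↥P ⧸ LinearMap.range f))

/-- `M` is a `U`-`k`-syzygy module: there is an exact sequence
`0 → M → X_0 → X_1 → ⋯ → X_{k-1}` with all `X_i` in `add U`. -/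
def IsUSyzygy : ℕ → ModuleCat.{0} R → Prop
  | 0, _ => True
  | k + 1, M => ∃ V : ModuleCat.{0} R, InAdd R U V ∧
      ∃ f : ↥M →ₗ[R] ↥V, Function.Injective f ∧
        IsUSyzygy k (ModuleCat.of R (↥V ⧸ LinearMap.range f))

/-- The injective dimension of `A` is at most `n` : there is an injective resolution
`0 → A → E_0 → ⋯ → E_n → 0`. -/
def injDimLE : ℕ → ModuleCat.{0} R → Prop
  | 0, A => Module.Injective R ↥A
  | n + 1, A => ∃ E : ModuleCat.{0} R, Module.Injective R ↥E ∧
      ∃ f : ↥A →ₗ[R] ↥E, Function.Injective f ∧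
        injDimLE n (ModuleCat.of R (↥E ⧸ LinearMap.range f))

/-- The injective dimension of `A`, as an element of `ℕ∞`. -/
def injDim (A : ModuleCat.{0} R) : ℕ∞ :=
  sInf {c : ℕ∞ | ∃ n : ℕ, c = n ∧ injDimLE R n A}

/-- `A` is a flat `R`-module (equational criterion for flatness, which makes sense
over an arbitrary, possibly noncommutative, ring): every relation in `A` can be
trivialized. -/
def IsFlat (A : Type) [AddCommGroup A] [Module R A] : Prop :=
  ∀ (n : ℕ) (a : Fin n → R) (x : Fin n → A), (∑ i, a i • x i) = 0 →
    ∃ (k : ℕ) (b : Fin n → Fin k → R) (y : Fin k → A),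
      (∀ i, x i = ∑ j, b i j • y j) ∧ ∀ j, (∑ i, a i * b i j) = 0

/-- The flat dimension of `A` is at most `n` : there is a flat resolution
`0 → F_n → ⋯ → F_0 → A → 0`. -/
def flatDimLE : ℕ → ModuleCat.{0} R → Prop
  | 0, A => IsFlat R ↥A
  | n + 1, A => ∃ F : ModuleCat.{0} R, IsFlat R ↥F ∧
      ∃ g : ↥F →ₗ[R] ↥A, Function.Surjective g ∧
        flatDimLE n (ModuleCat.of R ↥(LinearMap.ker g))

/-- `A` is cogenerated by `U` : it embeds into a direct product of copies of `U`. -/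
def Cogenerated (A : ModuleCat.{0} R) : Prop :=
  ∃ (ι : Type) (f : ↥A →ₗ[R] (ι → U)), Function.Injective f

/-- A minimal injective resolution `0 → M → E 0 → E 1 → ⋯` of `M` : an injective
resolution in which the kernel of each differential is an essential submodule. -/
structure MinInjRes (M : Type) [AddCommGroup M] [Module R M] where
  E : ℕ → ModuleCat.{0} R
  injective : ∀ n, Module.Injective R ↥(E n)
  ι : M →ₗ[R] ↥(E 0)
  d : ∀ n, ↥(E n) →ₗ[R] ↥(E (n + 1))
  ι_inj : Function.Injective ι
  exact_zero : LinearMap.ker (d 0) = LinearMap.range ι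
  exact_succ : ∀ n, LinearMap.ker (d (n + 1)) = LinearMap.range (d n)
  essential : ∀ n (B : Submodule R ↥(E n)), B ⊓ LinearMap.ker (d n) = ⊥ → B = ⊥

end Resol

section Bimodule

variable (Λ Γ : Type) [Ring Λ] [Ring Γ]
variable (U : Type) [AddCommGroup U] [Module Λ U] [Module Γᵐᵒᵖ U]
  [SMulCommClass Λ Γᵐᵒᵖ U] [SMulCommClass Γᵐᵒᵖ Λ U]

/-- Left multiplication `u ↦ a • u` as a `Γᵒᵖ`-linear endomorphism of `U`. -/
def lmul (a : Λ) : U →ₗ[Γᵐᵒᵖ] U where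
  toFun u := a • u
  map_add' := smul_add a
  map_smul' γ u := smul_comm a γ u

/-- Right multiplication `u ↦ u γ` as a `Λ`-linear endomorphism of `U`. -/
def rmul (γ : Γᵐᵒᵖ) : U →ₗ[Λ] U where
  toFun u := γ • u
  map_add' := smul_add γ
  map_smul' a u := smul_comm γ a u

/-- `U` is a faithfully balanced `(Λ,Γ)`-bimodule: the natural maps
`Λ → End(U_Γ)` and `Γ → End(_ΛU)^op` are isomorphisms. -/
def FaithfullyBalanced : Prop :=
  Function.Bijective (lmul Λ Γ U) ∧ Function.Bijective (rmul Λ Γ U)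

/-- `U` is selforthogonal: `Ext^i_Λ(U,U) = 0 = Ext^i_Γ(U,U)` for all `i ≥ 1`. -/
def SelfOrthogonal : Prop :=
  (∀ i, 1 ≤ i → extVanish Λ Γᵐᵒᵖ U (ModuleCat.of Λ U) i) ∧
  (∀ i, 1 ≤ i → extVanish Γᵐᵒᵖ Λ U (ModuleCat.of Γᵐᵒᵖ U) i)

/-- `_ΛU` is `k`-Gorenstein : `s.grade_U Ext^i_Γ(N,U) ≥ i` for every
`N ∈ mod Γᵒᵖ` and all `1 ≤ i ≤ k`. -/
def LeftGorenstein (k : ℕ) : Prop :=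
  ∀ N : ModuleCat.{0} Γᵐᵒᵖ, Module.Finite Γᵐᵒᵖ ↥N →
    ∀ i, 1 ≤ i → i ≤ k →
      sgradeGE Λ Γᵐᵒᵖ U (ModuleCat.of Λ (ExtU Γᵐᵒᵖ Λ U N i)) i

/-- `U_Γ` is `k`-Gorenstein : `s.grade_U Ext^i_Λ(M,U) ≥ i` for every
`M ∈ mod Λ` and all `1 ≤ i ≤ k`. -/
def RightGorenstein (k : ℕ) : Prop :=
  ∀ M : ModuleCat.{0} Λ, Module.Finite Λ ↥M →
    ∀ i, 1 ≤ i → i ≤ k →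
      sgradeGE Γᵐᵒᵖ Λ U (ModuleCat.of Γᵐᵒᵖ (ExtU Λ Γᵐᵒᵖ U M i)) i

end Bimodule

section Bridge

open CategoryTheory CategoryTheory.Abelian

/-- Vanishing of the Mathlib `Ext` group. -/
def ExtV (R : Type) [Ring R] (X U : Type) [AddCommGroup X] [Module R X]
    [AddCommGroup U] [Module R U] (n : ℕ) : Prop :=
  Subsingleton (Ext (ModuleCat.of R X) (ModuleCat.of R U) n)

section

variable {R : Type} [Ring R] {A B C U : Type} [AddCommGroup A] [Module R A]
  [AddCommGroup B] [Module R B] [AddCommGroup C] [Module R C] [AddCommGroup U] [Module R U]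

lemma sesE {i : A →ₗ[R] B} {p : B →ₗ[R] C} (hi : Function.Injective i)
    (hp : Function.Surjective p) (hex : Function.Exact i p) :
    (ModuleCat.shortComplexOfCompEqZero i p hex.linearMap_comp_eq_zero).ShortExact :=
  ModuleCat.shortComplex_shortExact _ hex hi hp

lemma extV_left {i : A →ₗ[R] B} {p : B →ₗ[R] C} (hi : Function.Injective i)
    (hp : Function.Surjective p) (hex : Function.Exact i p) {n : ℕ}
    (hB : ExtV R B U n) (hC : ExtV R C U (n + 1)) : ExtV R A U n := by
  unfold ExtV at *
  refine subsingleton_of_forall_eq 0 fun x => ?_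
  obtain ⟨y, rfl⟩ := Ext.contravariant_sequence_exact₁ (sesE hi hp hex) (ModuleCat.of R U) x
    (add_comm 1 n) (Subsingleton.elim (α := Ext (ModuleCat.of R C) (ModuleCat.of R U) (n + 1)) _ _)
  have : y = 0 := Subsingleton.elim (α := Ext (ModuleCat.of R B) (ModuleCat.of R U) n) _ _
  rw [this, Ext.comp_zero]

lemma extV_right {i : A →ₗ[R] B} {p : B →ₗ[R] C} (hi : Function.Injective i)
    (hp : Function.Surjective p) (hex : Function.Exact i p) {n : ℕ}
    (hA : ExtV R A U n) (hB : ExtV R B U (n + 1)) : ExtV R C U (n + 1) := by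
  unfold ExtV at *
  refine subsingleton_of_forall_eq 0 fun x => ?_
  obtain ⟨y, rfl⟩ := Ext.contravariant_sequence_exact₃ (sesE hi hp hex) (ModuleCat.of R U) x
    (Subsingleton.elim (α := Ext (ModuleCat.of R B) (ModuleCat.of R U) (n + 1)) _ _) (add_comm 1 n)
  have : y = 0 := Subsingleton.elim (α := Ext (ModuleCat.of R A) (ModuleCat.of R U) n) _ _
  rw [this, Ext.comp_zero]

lemma extV_mid {i : A →ₗ[R] B} {p : B →ₗ[R] C} (hi : Function.Injective i)
    (hp : Function.Surjective p) (hex : Function.Exact i p) {n : ℕ}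
    (hA : ExtV R A U n) (hC : ExtV R C U n) : ExtV R B U n := by
  unfold ExtV at *
  refine subsingleton_of_forall_eq 0 fun x => ?_
  obtain ⟨y, rfl⟩ := Ext.contravariant_sequence_exact₂ (sesE hi hp hex) (ModuleCat.of R U) x
    (Subsingleton.elim (α := Ext (ModuleCat.of R A) (ModuleCat.of R U) n) _ _)
  have : y = 0 := Subsingleton.elim (α := Ext (ModuleCat.of R C) (ModuleCat.of R U) n) _ _
  rw [this, Ext.comp_zero]

lemma extV_proj [Module.Projective R A] (n : ℕ) : ExtV R A U (n + 1) := by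
  have : Projective (ModuleCat.of R A) := (IsProjective.iff_projective A).1 inferInstance
  exact Ext.subsingleton_of_projective _ _ _

lemma extend_of_extV {i : A →ₗ[R] B} {p : B →ₗ[R] C} (hi : Function.Injective i)
    (hp : Function.Surjective p) (hex : Function.Exact i p)
    (hC : ExtV R C U 1) (f : A →ₗ[R] U) : ∃ h : B →ₗ[R] U, h.comp i = f := by
  obtain ⟨y, hy⟩ := Ext.contravariant_sequence_exact₁ (sesE hi hp hex) (ModuleCat.of R U)
    (Ext.mk₀ (ModuleCat.ofHom f)) (add_comm 1 0)
    (Subsingleton.elim (h := hC) (α := Ext (ModuleCat.of R C) (ModuleCat.of R U) 1) _ _)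
  obtain ⟨y, rfl⟩ := Ext.homEquiv₀.symm.surjective y
  have h2 : ModuleCat.ofHom i ≫ y = ModuleCat.ofHom f :=
    Ext.homEquiv₀.symm.injective (by simpa using hy)
  exact ⟨y.hom, by simpa using congrArg ModuleCat.Hom.hom h2⟩

lemma extV_of_extend {i : A →ₗ[R] B} {p : B →ₗ[R] C} (hi : Function.Injective i)
    (hp : Function.Surjective p) (hex : Function.Exact i p) (hB : ExtV R B U 1)
    (H : ∀ f : A →ₗ[R] U, ∃ h : B →ₗ[R] U, h.comp i = f) : ExtV R C U 1 := by
  unfold ExtV at *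
  refine subsingleton_of_forall_eq 0 fun x => ?_
  obtain ⟨y, rfl⟩ := Ext.contravariant_sequence_exact₃ (sesE hi hp hex) (ModuleCat.of R U) x
    (Subsingleton.elim (α := Ext (ModuleCat.of R B) (ModuleCat.of R U) 1) _ _) (add_comm 1 0)
  obtain ⟨y, rfl⟩ := Ext.homEquiv₀.symm.surjective y
  obtain ⟨h, hh⟩ := H y.hom
  have : y = ModuleCat.ofHom i ≫ ModuleCat.ofHom h := by
    ext1
    simp [hh]
  rw [this]
  have h3 := (sesE hi hp hex).extClass_comp_assoc (Ext.mk₀ (ModuleCat.ofHom h))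
    (h := add_comm 1 0)
  rw [Ext.mk₀_comp_mk₀] at h3
  exact h3

lemma cover_surj : Function.Surjective (cover R A) := fun a =>
  ⟨Finsupp.single a 1, by simp [cover]⟩

lemma exact_subtype_ker (p : B →ₗ[R] C) : Function.Exact (LinearMap.ker p).subtype p := by
  intro x; simp

lemma extV_congr (e : A ≃ₗ[R] B) {n : ℕ} (h : ExtV R A U (n + 1)) : ExtV R B U (n + 1) := by
  refine extV_right (A := PUnit) (i := (0 : PUnit →ₗ[R] A)) (p := e.toLinearMap)
    (Function.injective_of_subsingleton _) e.surjective ?_ ?_ h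
  · intro x; simp [@eq_comm _ (0 : A)]
  · cases n with
    | zero =>
      refine subsingleton_of_forall_eq 0 fun x => ?_
      obtain ⟨y, rfl⟩ := Ext.homEquiv₀.symm.surjective x
      have : y = 0 := by ext x; rw [Subsingleton.elim x 0]; simp
      simp [this]
    | succ n => exact extV_proj n

end

variable (R : Type) [Ring R] (S : Type) [Ring S]
variable (U : Type) [AddCommGroup U] [Module R U] [Module S U] [SMulCommClass R S U]

lemma ext1_iff (X : Type) [AddCommGroup X] [Module R X] :
    Subsingleton (Ext1 R S U X) ↔ ExtV R X U 1 := by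
  unfold Ext1
  rw [Submodule.Quotient.subsingleton_iff]
  constructor
  · intro h
    refine extV_of_extend (Subtype.val_injective) (cover_surj (R := R) (A := X))
      (exact_subtype_ker _) (extV_proj 0) fun f => ?_
    have : f ∈ ext1Sub R S U X := h ▸ Submodule.mem_top
    exact this
  · intro h
    rw [eq_top_iff]
    intro f _
    exact extend_of_extV Subtype.val_injective (cover_surj (R := R) (A := X))
      (exact_subtype_ker _) h f

lemma extV_syz (X : ModuleCat.{0} R) (n k : ℕ) :
    ExtV R ↥(syz R X n) U (k + 1) ↔ ExtV R X U (n + k + 1) := by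
  induction n generalizing k with
  | zero => rw [zero_add]; rfl
  | succ n ih =>
    have h1 : ExtV R ↥(syz R X (n + 1)) U (k + 1) ↔ ExtV R ↥(syz R X n) U (k + 1 + 1) :=
      ⟨fun h => extV_right (i := (LinearMap.ker (cover R (syz R X n))).subtype)
          Subtype.val_injective (cover_surj (R := R) (A := syz R X n))
          (exact_subtype_ker _) h (extV_proj _),
        fun h => extV_left (i := (LinearMap.ker (cover R (syz R X n))).subtype)
          Subtype.val_injective (cover_surj (R := R) (A := syz R X n))
          (exact_subtype_ker _) (extV_proj _) h⟩
    rw [h1, ih]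
    have : n + (k + 1) + 1 = n + 1 + k + 1 := by omega
    rw [this]

lemma extU_iff (X : ModuleCat.{0} R) (n : ℕ) :
    Subsingleton (ExtU R S U X (n + 1)) ↔ ExtV R X U (n + 1) := by
  rw [← extV_syz R U X n 0]
  exact ext1_iff R S U _

lemma hasInjDim_of_injDimLE (n : ℕ) (A : ModuleCat.{0} R) (h : injDimLE R n A) :
    HasInjectiveDimensionLT A (n + 1) := by
  induction n generalizing A with
  | zero =>
    have : Module.Injective R A := h
    have := Module.injective_object_of_injective_module R A
    change Injective A at this
    infer_instance
  | succ n ih =>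
    obtain ⟨E, hE, f, hf, h2⟩ := h
    have h3 := ih _ h2
    have : Injective E := Module.injective_object_of_injective_module R E
    have hses := sesE (i := f) (p := (LinearMap.range f).mkQ) hf (Submodule.mkQ_surjective _)
      (by intro x; simp)
    exact (hses.hasInjectiveDimensionLT_X₃_iff n this).1 h3

lemma extV_of_injDim (g : ℕ) (h : injDim R (ModuleCat.of R U) = (g : ℕ∞)) (X : Type)
    [AddCommGroup X] [Module R X] (n : ℕ) (hn : g < n) : ExtV R X U n := by
  have h1 : injDimLE R g (ModuleCat.of R U) := by
    have hne : {c : ℕ∞ | ∃ n : ℕ, c = n ∧ injDimLE R n (ModuleCat.of R U)}.Nonempty := by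
      by_contra hcon
      rw [Set.not_nonempty_iff_eq_empty] at hcon
      rw [injDim, hcon, sInf_empty] at h
      exact absurd h (by simp)
    have := csInf_mem hne
    rw [← injDim, h] at this
    obtain ⟨m, hm, hm2⟩ := this
    rwa [Nat.cast_inj.1 hm]
  have := hasInjDim_of_injDimLE R g _ h1
  exact HasInjectiveDimensionLT.subsingleton (ModuleCat.of R U) (g + 1) n hn _

end Bridge

section Shift

lemma exists_lift_inj {R : Type} [Ring R] {Y K P : Type} [AddCommGroup Y] [Module R Y]
    [AddCommGroup K] [Module R K] [AddCommGroup P] [Module R P]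
    {i : K →ₗ[R] P} (hi : Function.Injective i) (f : Y →ₗ[R] P)
    (h : ∀ y, f y ∈ LinearMap.range i) : ∃ ψ : Y →ₗ[R] K, i.comp ψ = f := by
  refine ⟨(LinearEquiv.ofInjective i hi).symm.toLinearMap.comp (f.codRestrict _ h), ?_⟩
  ext y
  simp

lemma exists_desc_surj {R : Type} [Ring R] {Y B C : Type} [AddCommGroup Y] [Module R Y]
    [AddCommGroup B] [Module R B] [AddCommGroup C] [Module R C]
    {p : B →ₗ[R] C} (hp : Function.Surjective p) (f : B →ₗ[R] Y)
    (h : ∀ b, p b = 0 → f b = 0) : ∃ k : C →ₗ[R] Y, k.comp p = f := by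
  refine ⟨((LinearMap.ker p).liftQ f (fun b hb => h b hb)).comp
    (p.quotKerEquivOfSurjective hp).symm.toLinearMap, ?_⟩
  ext b
  have : (p.quotKerEquivOfSurjective hp).symm (p b) = (LinearMap.ker p).mkQ b := by
    rw [LinearEquiv.symm_apply_eq]; rfl
  rw [LinearMap.comp_apply, LinearMap.comp_apply, LinearEquiv.coe_coe, this]
  exact Submodule.liftQ_apply _ _ _

variable {R : Type} [Ring R] (S : Type) [Ring S]
variable (U : Type) [AddCommGroup U] [Module R U] [Module S U] [SMulCommClass R S U]

variable {K P X : Type} [AddCommGroup K] [Module R K] [AddCommGroup P] [Module R P]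
  [AddCommGroup X] [Module R X]

lemma ext1_equiv {i : K →ₗ[R] P} {p : P →ₗ[R] X} (hi : Function.Injective i)
    (hp : Function.Surjective p) (hex : Function.Exact i p) (hP : ExtV R P U 1) :
    Nonempty (Ext1 R S U X ≃ₗ[S] ((K →ₗ[R] U) ⧸ LinearMap.range (precompS R S U i))) := by
  obtain ⟨φ, hφ⟩ := Module.projective_lifting_property p (cover R X) hp
  have hφ' : ∀ x, p (φ x) = cover R X x := fun x => LinearMap.congr_fun hφ x
  obtain ⟨ψ, hψ⟩ := exists_lift_inj (Y := ↥(LinearMap.ker (cover R X))) hi (φ.comp (LinearMap.ker (cover R X)).subtype) (by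
    intro y
    have : p (φ y.1) = 0 := by rw [hφ']; exact y.2
    exact (hex _).1 this)
  have hψ' : ∀ x, i (ψ x) = φ x.1 := fun x => LinearMap.congr_fun hψ x
  let T : ((K →ₗ[R] U) ⧸ LinearMap.range (precompS R S U i)) →ₗ[S] Ext1 R S U X :=
    Submodule.mapQ _ (ext1Sub R S U X) (precompS R S U ψ) (by
      rintro _ ⟨h, rfl⟩
      refine ⟨h.comp φ, ?_⟩
      ext y
      change h (φ y.1) = h (i (ψ y))
      rw [hψ'])
  refine ⟨(LinearEquiv.ofBijective T ⟨?_, ?_⟩).symm⟩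
  · rw [injective_iff_map_eq_zero]
    intro f
    obtain ⟨f, rfl⟩ := Submodule.mkQ_surjective _ f
    intro hf
    have hf2 : precompS R S U ψ f ∈ ext1Sub R S U X :=
      (Submodule.Quotient.mk_eq_zero (p := ext1Sub R S U X)).1 hf
    obtain ⟨h, hh⟩ := hf2
    have hh' : ∀ y : LinearMap.ker (cover R X), h y.1 = f (ψ y) :=
      fun y => LinearMap.congr_fun hh y
    refine (Submodule.Quotient.mk_eq_zero _).2 ?_
    have hsurj : Function.Surjective (i.coprod φ) := by
      intro z
      obtain ⟨b, hb⟩ := cover_surj (R := R) (p z)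
      obtain ⟨k, hk⟩ := (hex (z - φ b)).1 (by rw [map_sub, hφ', hb, sub_self])
      exact ⟨(k, b), by simp [hk]⟩
    obtain ⟨t, ht⟩ := exists_desc_surj hsurj (f.coprod h) (by
      rintro ⟨k, b⟩ hkb
      simp only [LinearMap.coprod_apply] at hkb ⊢
      have hb : cover R X b = 0 := by
        have := congrArg p hkb
        rw [map_add, hφ', hex.apply_apply_eq_zero, map_zero, zero_add] at this
        exact this
      have hk : k = - ψ ⟨b, hb⟩ := by
        apply hi
        rw [map_neg, hψ']
        exact eq_neg_of_add_eq_zero_left hkb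
      rw [hk, map_neg, ← hh']
      simp)
    refine ⟨t, ?_⟩
    ext k
    have := LinearMap.congr_fun ht (k, 0)
    simpa [precompS] using this
  · intro f
    obtain ⟨f, rfl⟩ := Submodule.mkQ_surjective (ext1Sub R S U X) f
    let i' : ↥(LinearMap.ker (cover R X)) →ₗ[R] K × (X →₀ R) :=
      (-ψ).prod (LinearMap.ker (cover R X)).subtype
    have hi' : ∀ y, i' y = (-ψ y, y.1) := fun y => rfl
    let p' : K × (X →₀ R) →ₗ[R] P := i.coprod φ
    have hp' : ∀ a b, p' (a, b) = i a + φ b := fun a b => rfl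
    obtain ⟨h, hh⟩ := extend_of_extV (A := ↥(LinearMap.ker (cover R X)))
      (B := K × (X →₀ R)) (C := P) (U := U) (i := i') (p := p')
      (by
        intro a b hab
        exact Subtype.ext (congrArg Prod.snd hab))
      (by
        intro z
        obtain ⟨b, hb⟩ := cover_surj (R := R) (p z)
        obtain ⟨k, hk⟩ := (hex (z - φ b)).1 (by rw [map_sub, hφ', hb, sub_self])
        exact ⟨(k, b), by simp [hk, hp']⟩)
      (by
        rintro ⟨k, b⟩
        constructor
        · intro hkb
          rw [hp'] at hkb
          have hb : cover R X b = 0 := by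
            have := congrArg p hkb
            rw [map_add, hφ', hex.apply_apply_eq_zero, map_zero, zero_add] at this
            exact this
          refine ⟨⟨b, hb⟩, ?_⟩
          have hk : k = - ψ ⟨b, hb⟩ := by
            apply hi
            rw [map_neg, hψ']
            exact eq_neg_of_add_eq_zero_left hkb
          rw [hi', hk]
        · rintro ⟨y, hy⟩
          rw [← hy]
          simp [hψ', hi', hp'])
      hP f
    refine ⟨Submodule.Quotient.mk (-(h.comp (LinearMap.inl R K _))), ?_⟩
    refine (Submodule.Quotient.eq (ext1Sub R S U X)).2 ?_
    refine ⟨-(h.comp (LinearMap.inr R K _)), ?_⟩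
    ext y
    have h1 := LinearMap.congr_fun hh y
    have h2 : h (-ψ y, y.1) = -h (ψ y, 0) + h (0, y.1) := by
      rw [← map_neg h, ← map_add h]; simp
    have h3 : h (-ψ y, y.1) = f y := h1
    simp only [precompS, LinearMap.coe_mk, AddHom.coe_mk, LinearMap.comp_apply,
      LinearMap.neg_apply, LinearMap.sub_apply, Submodule.subtype_apply, LinearMap.inl_apply,
      LinearMap.inr_apply]
    rw [← h3, h2]
    abel

lemma horseshoe {i : K →ₗ[R] P} {p : P →ₗ[R] X} (hi : Function.Injective i)
    (hp : Function.Surjective p) (hex : Function.Exact i p) (hP : ∀ n, ExtV R P U (n + 1)) :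
    ∃ (P' : ModuleCat.{0} R) (ι : ↥(LinearMap.ker (cover R K)) →ₗ[R] ↥P')
      (π : ↥P' →ₗ[R] ↥(LinearMap.ker (cover R X))),
      Function.Injective ι ∧ Function.Surjective π ∧ Function.Exact ι π ∧
      (∀ n, ExtV R ↥P' U (n + 1)) ∧
      LinearMap.range (precompS R S U ι) = ext1Sub R S U K := by
  obtain ⟨φ, hφ⟩ := Module.projective_lifting_property p (cover R X) hp
  have hφ' : ∀ x, p (φ x) = cover R X x := fun x => LinearMap.congr_fun hφ x
  let q : ((K →₀ R) × (X →₀ R)) →ₗ[R] P := (i.comp (cover R K)).coprod φ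
  have hq : ∀ a b, q (a, b) = i (cover R K a) + φ b := fun a b => rfl
  have hqs : Function.Surjective q := by
    intro z
    obtain ⟨b, hb⟩ := cover_surj (R := R) (p z)
    obtain ⟨k, hk⟩ := (hex (z - φ b)).1 (by rw [map_sub, hφ', hb, sub_self])
    obtain ⟨a, ha⟩ := cover_surj (R := R) k
    exact ⟨(a, b), by rw [hq, ha, hk]; simp⟩
  let ι : ↥(LinearMap.ker (cover R K)) →ₗ[R] ↥(LinearMap.ker q) :=
    LinearMap.codRestrict _ ((LinearMap.inl R _ _).comp (LinearMap.ker (cover R K)).subtype)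
      (fun c => by
        have := c.2
        rw [LinearMap.mem_ker] at this
        change q (c.1, 0) = 0
        rw [hq, this]; simp)
  let π : ↥(LinearMap.ker q) →ₗ[R] ↥(LinearMap.ker (cover R X)) :=
    LinearMap.codRestrict _ ((LinearMap.snd R _ _).comp (LinearMap.ker q).subtype)
      (fun c => by
        have h1 : i (cover R K c.1.1) + φ c.1.2 = 0 := c.2
        have := congrArg p h1
        rw [map_add, hφ', hex.apply_apply_eq_zero, map_zero, zero_add] at this
        exact this)
  refine ⟨ModuleCat.of R (LinearMap.ker q), ι, π, ?_, ?_, ?_, ?_, ?_⟩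
  · intro a b hab
    exact Subtype.ext (congrArg (fun z => z.1.1) hab)
  · rintro ⟨b, hb⟩
    obtain ⟨k, hk⟩ := (hex (φ b)).1 (by rw [hφ']; exact hb)
    obtain ⟨a, ha⟩ := cover_surj (R := R) k
    refine ⟨⟨(-a, b), ?_⟩, rfl⟩
    change q (-a, b) = 0
    rw [hq, map_neg, ha, map_neg, hk]; simp
  · rintro ⟨⟨a, b⟩, hab⟩
    constructor
    · intro h
      have hb : b = 0 := congrArg Subtype.val h
      subst hb
      have h1 : i (cover R K a) + φ 0 = 0 := hab
      rw [map_zero, add_zero] at h1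
      refine ⟨⟨a, hi (h1.trans (map_zero i).symm)⟩, rfl⟩
    · rintro ⟨y, hy⟩
      rw [← hy]; rfl
  · intro n
    exact extV_left (i := (LinearMap.ker q).subtype) Subtype.val_injective hqs
      (exact_subtype_ker _) (extV_proj n) (hP (n + 1))
  · apply le_antisymm
    · rintro _ ⟨f, rfl⟩
      obtain ⟨h, hh⟩ := extend_of_extV (U := U) (i := (LinearMap.ker q).subtype)
        Subtype.val_injective hqs (exact_subtype_ker _) (hP 0) f
      refine ⟨h.comp (LinearMap.inl R _ _), ?_⟩
      ext y
      exact LinearMap.congr_fun hh (ι y)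
    · rintro _ ⟨f, rfl⟩
      exact ⟨(f.comp (LinearMap.fst R _ _)).comp (LinearMap.ker q).subtype, rfl⟩

lemma syz_shift (X : ModuleCat.{0} R) (n : ℕ) :
    syz R (ModuleCat.of R ↥(LinearMap.ker (cover R X))) n = syz R X (n + 1) := by
  induction n with
  | zero => rfl
  | succ n ih =>
    change ModuleCat.of R (LinearMap.ker (cover R (syz R _ n))) = _
    rw [ih]; rfl

lemma extU_shift_self (X : ModuleCat.{0} R) (n : ℕ) :
    Nonempty (ExtU R S U X (n + 2) ≃ₗ[S]
      ExtU R S U (ModuleCat.of R ↥(LinearMap.ker (cover R X))) (n + 1)) := by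
  change Nonempty (Ext1 R S U (syz R X (n + 1)) ≃ₗ[S] Ext1 R S U (syz R _ n))
  rw [syz_shift]
  exact ⟨LinearEquiv.refl _ _⟩

lemma extU_shift (n : ℕ) (K P X : ModuleCat.{0} R) (i : ↥K →ₗ[R] ↥P) (p : ↥P →ₗ[R] ↥X)
    (hi : Function.Injective i)
    (hp : Function.Surjective p) (hex : Function.Exact i p) (hP : ∀ n, ExtV R P U (n + 1)) :
    Nonempty (ExtU R S U X (n + 2) ≃ₗ[S] ExtU R S U K (n + 1)) := by
  induction n generalizing K P X with
  | zero =>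
    obtain ⟨P', ι, π, h1, h2, h3, h4, h5⟩ := horseshoe S U hi hp hex hP
    obtain ⟨e⟩ := ext1_equiv (K := ↥(LinearMap.ker (cover R K))) (P := P')
      (X := ↥(LinearMap.ker (cover R X))) S U (i := ι) (p := π) h1 h2 h3 (h4 0)
    exact ⟨e.trans (Submodule.quotEquivOfEq _ _ h5)⟩
  | succ n ih =>
    obtain ⟨P', ι, π, h1, h2, h3, h4, h5⟩ := horseshoe S U hi hp hex hP
    obtain ⟨e⟩ := ih (ModuleCat.of R ↥(LinearMap.ker (cover R K))) P'
      (ModuleCat.of R ↥(LinearMap.ker (cover R X))) ι π h1 h2 h3 h4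
    obtain ⟨e1⟩ := extU_shift_self S U X (n + 1)
    obtain ⟨e2⟩ := extU_shift_self S U K n
    exact ⟨e1.trans (e.trans e2.symm)⟩

lemma extU_congr (X Y : ModuleCat.{0} R) (e : ↥X ≃ₗ[R] ↥Y) (n : ℕ) :
    Nonempty (ExtU R S U X n ≃ₗ[S] ExtU R S U Y n) := by
  have hs : Function.Surjective (e.toLinearMap.comp (cover R X)) :=
    e.surjective.comp cover_surj
  have hex : Function.Exact (LinearMap.ker (cover R X)).subtype
      (e.toLinearMap.comp (cover R X)) := by
    intro x; simp
  match n with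
  | 0 =>
    refine ⟨LinearEquiv.ofLinearMap (precompS R S U e.symm.toLinearMap)
      (precompS R S U e.toLinearMap) ?_ ?_⟩
    · refine LinearMap.ext fun f => LinearMap.ext fun x => ?_
      exact congrArg (show _ →ₗ[R] U from f) (e.apply_symm_apply x)
    · refine LinearMap.ext fun f => LinearMap.ext fun x => ?_
      exact congrArg (show _ →ₗ[R] U from f) (e.symm_apply_apply x)
  | 1 =>
    obtain ⟨e1⟩ := ext1_equiv (K := ↥(LinearMap.ker (cover R X)))
      (P := (X →₀ R)) (X := Y) S U (i := (LinearMap.ker (cover R X)).subtype)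
      Subtype.val_injective hs hex (extV_proj 0)
    exact ⟨e1.symm⟩
  | n + 2 =>
    obtain ⟨e1⟩ := extU_shift S U n (ModuleCat.of R ↥(LinearMap.ker (cover R X)))
      (ModuleCat.of R (X →₀ R)) Y _ _ Subtype.val_injective hs hex (fun n => extV_proj n)
    obtain ⟨e2⟩ := extU_shift_self S U X n
    exact ⟨e2.trans e1.symm⟩

end Shift

section Dual

set_option linter.unusedSectionVars false

variable {R : Type} [Ring R] {S : Type} [Ring S]
variable {U : Type} [AddCommGroup U] [Module R U] [Module S U] [SMulCommClass R S U]

section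

variable {K P X : Type} [AddCommGroup K] [Module R K] [AddCommGroup P] [Module R P]
  [AddCommGroup X] [Module R X]

lemma precompS_apply (t : K →ₗ[R] P) (f : P →ₗ[R] U) (x : K) :
    precompS R S U t f x = f (t x) := rfl

lemma precompS_inj {p : P →ₗ[R] X} (hp : Function.Surjective p) :
    Function.Injective (precompS R S U p) := by
  intro f g hfg
  ext x
  obtain ⟨y, rfl⟩ := hp x
  exact LinearMap.congr_fun hfg y

lemma precompS_exact {i : K →ₗ[R] P} {p : P →ₗ[R] X}
    (hp : Function.Surjective p) (hex : Function.Exact i p) :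
    Function.Exact (precompS R S U p) (precompS R S U i) := by
  intro f
  constructor
  · intro h
    obtain ⟨k, hk⟩ := exists_desc_surj hp f (by
      intro b hb
      obtain ⟨a, rfl⟩ := (hex b).1 hb
      exact LinearMap.congr_fun h a)
    exact ⟨k, hk⟩
  · rintro ⟨k, rfl⟩
    ext a
    rw [precompS_apply, precompS_apply, hex.apply_apply_eq_zero]
    simp

lemma precompS_surj {i : K →ₗ[R] P} {p : P →ₗ[R] X} (hi : Function.Injective i)
    (hp : Function.Surjective p) (hex : Function.Exact i p) (hX : ExtV R X U 1) :
    Function.Surjective (precompS R S U i) := fun f =>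
  extend_of_extV hi hp hex hX f

end

variable [SMulCommClass S R U]

/-- Evaluation `X → Hom_S(L, U)` for a map `L → Hom_R(X, U)`. -/
def evL {X L : Type} [AddCommGroup X] [Module R X] [AddCommGroup L] [Module S L]
    (l : L →ₗ[S] (X →ₗ[R] U)) : X →ₗ[R] (L →ₗ[S] U) where
  toFun x :=
    { toFun := fun a => l a x
      map_add' := fun a b => by rw [map_add]; rfl
      map_smul' := fun s a => by rw [map_smul]; rfl }
  map_add' x y := by ext a; exact map_add (l a) x y
  map_smul' r x := by ext a; exact map_smul (l a) r x

lemma evL_apply {X L : Type} [AddCommGroup X] [Module R X] [AddCommGroup L] [Module S L]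
    (l : L →ₗ[S] (X →ₗ[R] U)) (x : X) (a : L) : evL l x a = l a x := rfl

variable (R S U) in
/-- The standing (one-sided) assumptions on the bimodule. -/
structure Setup (g : ℕ) : Prop where
  faith : ∀ r : R, (∀ u : U, r • u = 0) → r = 0
  bal : ∀ φ : U →ₗ[S] U, ∃ r : R, ∀ u, φ u = r • u
  orth : ∀ n, ExtV S U U (n + 1)
  idS : injDim S (ModuleCat.of S U) = (g : ℕ∞)
  idR : injDim R (ModuleCat.of R U) = (g : ℕ∞)

variable {g : ℕ}

lemma ev_free_inj (H : Setup R S U g) (n : ℕ) (p : Fin n → R)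
    (hp : ∀ f : (Fin n → R) →ₗ[R] U, f p = 0) : p = 0 := by
  funext i
  refine H.faith _ fun u => ?_
  exact hp ((LinearMap.toSpanSingleton R U u).comp (LinearMap.proj i))

lemma ev_free_surj (H : Setup R S U g) (n : ℕ) (Φ : ((Fin n → R) →ₗ[R] U) →ₗ[S] U) :
    ∃ p : Fin n → R, ∀ f, Φ f = f p := by
  let b : Fin n → U →ₗ[S] ((Fin n → R) →ₗ[R] U) := fun i =>
    { toFun := fun u => (LinearMap.toSpanSingleton R U u).comp (LinearMap.proj i)
      map_add' := fun u v => by ext; simp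
      map_smul' := fun s u => LinearMap.ext fun p => smul_comm (p i) s u }
  have hb : ∀ i u p, b i u p = p i • u := fun i u p => rfl
  choose r hr using fun i => H.bal (Φ.comp (b i))
  refine ⟨r, fun f => ?_⟩
  have hf : f = ∑ i, b i (f (Pi.single i 1)) := by
    refine LinearMap.ext fun p => ?_
    rw [LinearMap.sum_apply]
    simp only [hb]
    conv_lhs => rw [← Finset.univ_sum_single p]
    rw [map_sum]
    refine Finset.sum_congr rfl fun i _ => ?_
    rw [← map_smul]
    congr 1
    ext j
    by_cases hij : j = i
    · subst hij; simp
    · simp [hij]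
  have h1 : ∀ i, Φ (b i (f (Pi.single i 1))) = r i • f (Pi.single i 1) := fun i => hr i _
  conv_lhs => rw [hf]
  conv_rhs => rw [hf]
  rw [map_sum, LinearMap.sum_apply]
  exact Finset.sum_congr rfl fun i _ => h1 i

lemma pow_acyc (H : Setup R S U g) (n m : ℕ) : ExtV S (Fin n → U) U (m + 1) := by
  induction n with
  | zero => exact extV_proj m
  | succ n ih =>
    refine extV_mid (i := LinearMap.single S (fun _ : Fin (n + 1) => U) 0)
      (p := LinearMap.funLeft S U Fin.succ) ?_ ?_ ?_ (H.orth m) ih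
    · intro a b h
      simpa using congrFun h 0
    · intro f
      exact ⟨Fin.cons 0 f, by ext j; simp [LinearMap.funLeft]⟩
    · intro f
      constructor
      · intro h
        refine ⟨f 0, ?_⟩
        ext j
        refine Fin.cases ?_ (fun k => ?_) j
        · simp
        · have := congrFun h k
          simp [LinearMap.funLeft] at this
          simp [this]
      · rintro ⟨u, rfl⟩
        ext j
        simp [LinearMap.funLeft]

lemma free_dual_acyc (H : Setup R S U g) (n m : ℕ) :
    ExtV S ((Fin n → R) →ₗ[R] U) U (m + 1) :=
  extV_congr ((Pi.basisFun R (Fin n)).constr S) (pow_acyc H n m)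

variable [IsNoetherianRing R]

lemma acyc_dual_aux (H : Setup R S U g) (k m : ℕ) (hk : g < m + 1 + k)
    (X : Type) [AddCommGroup X] [Module R X] [Module.Finite R X]
    (hX : ∀ n, ExtV R X U (n + 1)) : ExtV S (X →ₗ[R] U) U (m + 1) := by
  induction k generalizing X m with
  | zero => exact extV_of_injDim S U g H.idS _ _ hk
  | succ k ih =>
    obtain ⟨n, p, hp⟩ := Module.Finite.exists_fin' R X
    have hK : ∀ n, ExtV R (LinearMap.ker p) U (n + 1) := fun n =>
      extV_left (i := (LinearMap.ker p).subtype) Subtype.val_injective hp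
        (exact_subtype_ker p) (extV_proj n) (hX (n + 1))
    have h1 := ih (m + 1) (by omega) (LinearMap.ker p) hK
    exact extV_left (precompS_inj hp)
      (precompS_surj (S := S) (i := (LinearMap.ker p).subtype) Subtype.val_injective hp
        (exact_subtype_ker p) (hX 0))
      (precompS_exact hp (exact_subtype_ker p)) (free_dual_acyc H n m) h1

lemma acyc_dual (H : Setup R S U g)
    (X : Type) [AddCommGroup X] [Module R X] [Module.Finite R X]
    (hX : ∀ n, ExtV R X U (n + 1)) (m : ℕ) : ExtV S (X →ₗ[R] U) U (m + 1) :=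
  acyc_dual_aux H g m (by omega) X hX

lemma ev_surj (H : Setup R S U g)
    (X : Type) [AddCommGroup X] [Module R X] [Module.Finite R X]
    (hX : ∀ n, ExtV R X U (n + 1)) (Φ : (X →ₗ[R] U) →ₗ[S] U) : ∃ x : X, ∀ f, Φ f = f x := by
  obtain ⟨n, p, hp⟩ := Module.Finite.exists_fin' R X
  have hK : ∀ n, ExtV R (LinearMap.ker p) U (n + 1) := fun n =>
    extV_left (i := (LinearMap.ker p).subtype) Subtype.val_injective hp
      (exact_subtype_ker p) (extV_proj n) (hX (n + 1))
  obtain ⟨Ψ, hΨ⟩ := extend_of_extV (precompS_inj (S := S) (U := U) hp)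
    (precompS_surj (S := S) (i := (LinearMap.ker p).subtype) Subtype.val_injective hp
        (exact_subtype_ker p) (hX 0))
    (precompS_exact hp (exact_subtype_ker p)) (acyc_dual H (LinearMap.ker p) hK 0) Φ
  obtain ⟨q, hq⟩ := ev_free_surj H n Ψ
  refine ⟨p q, fun f => ?_⟩
  rw [← hΨ]
  exact hq _

lemma ev_inj (H : Setup R S U g)
    (X : Type) [AddCommGroup X] [Module R X] [Module.Finite R X]
    (hX : ∀ n, ExtV R X U (n + 1)) (x : X) (hx : ∀ f : X →ₗ[R] U, f x = 0) : x = 0 := by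
  obtain ⟨n, p, hp⟩ := Module.Finite.exists_fin' R X
  have hK : ∀ n, ExtV R (LinearMap.ker p) U (n + 1) := fun n =>
    extV_left (i := (LinearMap.ker p).subtype) Subtype.val_injective hp
      (exact_subtype_ker p) (extV_proj n) (hX (n + 1))
  obtain ⟨q, rfl⟩ := hp x
  obtain ⟨Ψ, hΨ⟩ := exists_desc_surj (Y := U)
    (p := precompS R S U (LinearMap.ker p).subtype)
    (precompS_surj (S := S) (i := (LinearMap.ker p).subtype) Subtype.val_injective hp
        (exact_subtype_ker p) (hX 0)) (evL (R := R) LinearMap.id q) (by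
      intro f hf
      obtain ⟨k, rfl⟩ := (precompS_exact (S := S) hp (exact_subtype_ker p) f).1 hf
      exact hx k)
  obtain ⟨k, hk⟩ := ev_surj H (LinearMap.ker p) hK Ψ
  have : q = k.1 := by
    rw [← sub_eq_zero]
    refine ev_free_inj H n _ fun f => ?_
    have h1 := LinearMap.congr_fun hΨ f
    have h2 : Ψ (precompS R S U (LinearMap.ker p).subtype f) = f q := h1
    rw [hk] at h2
    rw [map_sub, ← h2]
    exact sub_self _
  rw [this]
  exact k.2

end Dual

section Stages

/-- `A ≅ M` if `i = j`, and `A = 0` otherwise. -/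
def Good (R : Type) [Ring R] (j i : ℕ) (A M : Type) [AddCommGroup A] [Module R A]
    [AddCommGroup M] [Module R M] : Prop :=
  (i = j → Nonempty (A ≃ₗ[R] M)) ∧ (i ≠ j → Subsingleton A)

lemma Good.congr {R : Type} [Ring R] {j i : ℕ} {A B M : Type} [AddCommGroup A] [Module R A]
    [AddCommGroup M] [Module R M] [AddCommGroup B] [Module R B] (h : Good R j i A M)
    (e : Nonempty (B ≃ₗ[R] A)) : Good R j i B M := by
  obtain ⟨e⟩ := e
  refine ⟨fun hij => ?_, fun hij => ?_⟩
  · obtain ⟨e'⟩ := h.1 hij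
    exact ⟨e.trans e'⟩
  · have := h.2 hij
    exact e.toEquiv.subsingleton

lemma Good.succ {R : Type} [Ring R] {j i : ℕ} {A M : Type} [AddCommGroup A] [Module R A]
    [AddCommGroup M] [Module R M] (h : Good R j i A M) : Good R (j + 1) (i + 1) A M :=
  ⟨fun hij => h.1 (by omega), fun hij => h.2 (by omega)⟩

variable {R : Type} [Ring R] {S : Type} [Ring S]
variable {U : Type} [AddCommGroup U] [Module R U] [Module S U] [SMulCommClass R S U]
  [SMulCommClass S R U]

variable (S U) in
/-- The inductive datum at stage `j`. -/
def Stage (M : ModuleCat.{0} R) (j : ℕ) : Prop :=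
  ∃ (K : ModuleCat.{0} R) (L : ModuleCat.{0} S) (l : ↥L →ₗ[S] (↥K →ₗ[R] U)),
    Module.Finite R ↥K ∧ Function.Injective l ∧
    Nonempty (((↥K →ₗ[R] U) ⧸ LinearMap.range l) ≃ₗ[S] ExtU R S U M j) ∧
    (∀ i, Nonempty (ExtU R S U K (i + 1) ≃ₗ[S] ExtU R S U M (i + 1 + j))) ∧
    Good R j 0 (LinearMap.ker (evL l)) ↥M ∧
    Good R j 1 ((↥L →ₗ[S] U) ⧸ LinearMap.range (evL l)) ↥M ∧
    ∀ i, Good R j (i + 2) (ExtU S R U L (i + 1)) ↥M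

lemma stage_zero (M : ModuleCat.{0} R) [Module.Finite R M] : Stage S U M 0 := by
  have hsub : Subsingleton (↥(ModuleCat.of S PUnit) →ₗ[S] U) :=
    ⟨fun f g => LinearMap.ext fun x => by rw [Subsingleton.elim x 0]; simp⟩
  refine ⟨M, ModuleCat.of S PUnit, 0, inferInstance, Function.injective_of_subsingleton _,
    ?_, fun i => ⟨LinearEquiv.refl _ _⟩, ⟨fun _ => ?_, fun h => absurd rfl h⟩,
    ⟨fun h => absurd h (by omega), fun _ => ?_⟩, fun i => ⟨fun h => absurd h (by omega),
    fun _ => ?_⟩⟩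
  · exact ⟨Submodule.quotEquivOfEqBot _ LinearMap.range_zero⟩
  · have : LinearMap.ker (evL (0 : ↥(ModuleCat.of S PUnit) →ₗ[S] (↥M →ₗ[R] U))) = ⊤ := by
      rw [eq_top_iff]
      intro x _
      exact Subsingleton.elim _ _
    exact ⟨(LinearEquiv.ofEq _ _ this).trans Submodule.topEquiv⟩
  · exact (Submodule.mkQ_surjective _).subsingleton
  · rw [extU_iff]
    have : Subsingleton ↥(ModuleCat.of S PUnit) := inferInstanceAs (Subsingleton PUnit)
    exact extV_proj i

variable {g : ℕ}

lemma stage_one_iso (H : Setup R S U g) {K L : Type} [AddCommGroup K] [Module R K]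
    [AddCommGroup L] [Module S L] (l : L →ₗ[S] (K →ₗ[R] U)) (hl : Function.Surjective l)
    {n : ℕ} (p : (Fin n → R) →ₗ[R] K) (hp : Function.Surjective p) :
    Nonempty (((↥(LinearMap.range (precompS R S U (LinearMap.ker p).subtype)) →ₗ[S] U) ⧸
      LinearMap.range (evL (R := R) (S := S) (U := U) (X := ↥(LinearMap.ker p))
        (LinearMap.range (precompS R S U (LinearMap.ker p).subtype)).subtype)) ≃ₗ[R]
      LinearMap.ker (evL l)) := by
  set q := (precompS R S U (LinearMap.ker p).subtype).rangeRestrict with hq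
  have hqs : Function.Surjective q := LinearMap.surjective_rangeRestrict _
  choose θ hθ using fun Φ : (↥(LinearMap.range (precompS R S U (LinearMap.ker p).subtype))
    →ₗ[S] U) => ev_free_surj H n (Φ.comp q)
  have hθ' : ∀ (Φ : ↥(LinearMap.range (precompS R S U (LinearMap.ker p).subtype)) →ₗ[S] U)
      (f : (Fin n → R) →ₗ[R] U), f (θ Φ) = Φ (q f) := fun Φ f => (hθ Φ f).symm
  have huniq : ∀ a b : Fin n → R, (∀ f : (Fin n → R) →ₗ[R] U, f a = f b) → a = b := by
    intro a b h
    rw [← sub_eq_zero]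
    exact ev_free_inj H n _ fun f => by rw [map_sub, h, sub_self]
  let T0 : (↥(LinearMap.range (precompS R S U (LinearMap.ker p).subtype)) →ₗ[S] U) →ₗ[R]
      (Fin n → R) :=
    { toFun := θ
      map_add' := fun a b => huniq _ _ fun f => by
        rw [map_add, hθ', hθ', hθ']; rfl
      map_smul' := fun r a => huniq _ _ fun f => by
        rw [map_smul, hθ', hθ']; rfl }
  let T : (↥(LinearMap.range (precompS R S U (LinearMap.ker p).subtype)) →ₗ[S] U) →ₗ[R]
      LinearMap.ker (evL l) :=
    LinearMap.codRestrict _ (p.comp T0) (by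
      intro Φ
      rw [LinearMap.mem_ker]
      refine LinearMap.ext fun a => ?_
      change ((l a).comp p) (θ Φ) = 0
      rw [hθ']
      have : q ((l a).comp p) = 0 := by
        apply Subtype.ext
        refine LinearMap.ext fun x => ?_
        change l a (p x.1) = 0
        rw [x.2, map_zero]
      rw [this, map_zero])
  have hT : ∀ Φ, (T Φ).1 = p (θ Φ) := fun Φ => rfl
  have hTs : Function.Surjective T := by
    rintro ⟨x, hx⟩
    obtain ⟨y, rfl⟩ := hp x
    obtain ⟨Φ, hΦ⟩ := exists_desc_surj (Y := U) hqs
      (evL (R := R) (LinearMap.id : ((Fin n → R) →ₗ[R] U) →ₗ[S] ((Fin n → R) →ₗ[R] U)) y) (by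
        intro f hf
        have hf' : precompS R S U (LinearMap.ker p).subtype f = 0 := congrArg Subtype.val hf
        obtain ⟨k, rfl⟩ := (precompS_exact (S := S) hp (exact_subtype_ker p) f).1 hf'
        obtain ⟨a, rfl⟩ := hl k
        exact LinearMap.congr_fun hx a)
    refine ⟨Φ, Subtype.ext ?_⟩
    rw [hT]
    congr 1
    refine huniq _ _ fun f => ?_
    rw [hθ']
    exact LinearMap.congr_fun hΦ f
  have hk : LinearMap.range (evL (R := R) (S := S) (U := U) (X := ↥(LinearMap.ker p))
      (LinearMap.range (precompS R S U (LinearMap.ker p).subtype)).subtype) = LinearMap.ker T := by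
    ext Φ
    rw [LinearMap.mem_ker]
    constructor
    · rintro ⟨k, rfl⟩
      apply Subtype.ext
      rw [hT]
      have : θ (evL (R := R) (S := S) (U := U) (X := ↥(LinearMap.ker p)) (LinearMap.range
        (precompS R S U (LinearMap.ker p).subtype)).subtype k) = k.1 := by
        refine huniq _ _ fun f => ?_
        rw [hθ']
        rfl
      rw [this]
      exact k.2
    · intro h
      have h2 : p (θ Φ) = 0 := by rw [← hT, h]; rfl
      refine ⟨⟨θ Φ, h2⟩, ?_⟩
      refine LinearMap.ext fun a => ?_
      obtain ⟨f, rfl⟩ := hqs a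
      exact hθ' Φ f
  exact ⟨(Submodule.quotEquivOfEq _ _ hk).trans (T.quotKerEquivOfSurjective hTs)⟩

variable [IsNoetherianRing R]

lemma stage_succ (H : Setup R S U g) (M : ModuleCat.{0} R) (j : ℕ)
    (hj : Subsingleton (ExtU R S U M j)) (h : Stage S U M j) : Stage S U M (j + 1) := by
  obtain ⟨K, L, l, hK, hl, ⟨e0⟩, hE, h0, h1, h2⟩ := h
  have hls : Function.Surjective l := by
    have : Subsingleton ((↥K →ₗ[R] U) ⧸ LinearMap.range l) := e0.toEquiv.subsingleton
    rw [Submodule.Quotient.subsingleton_iff] at this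
    exact LinearMap.range_eq_top.1 this
  obtain ⟨n, p, hp⟩ := Module.Finite.exists_fin' R K
  let i : ↥(LinearMap.ker p) →ₗ[R] (Fin n → R) := (LinearMap.ker p).subtype
  have hi : Function.Injective i := Subtype.val_injective
  have hex : Function.Exact i p := exact_subtype_ker p
  let w := precompS R S U i
  -- the short exact sequence `0 → L → P^* → L' → 0`
  let a : ↥L →ₗ[S] ((Fin n → R) →ₗ[R] U) := (precompS R S U p).comp l
  have ha : Function.Injective a := (precompS_inj (S := S) (U := U) hp).comp hl
  have hw : Function.Surjective w.rangeRestrict := LinearMap.surjective_rangeRestrict _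
  have haw : Function.Exact a w.rangeRestrict := by
    intro f
    have h3 := precompS_exact (S := S) (U := U) hp hex f
    constructor
    · intro hf
      obtain ⟨k, hk⟩ := h3.1 (congrArg Subtype.val hf)
      obtain ⟨b, rfl⟩ := hls k
      exact ⟨b, hk⟩
    · rintro ⟨b, rfl⟩
      exact Subtype.ext (h3.2 ⟨l b, rfl⟩)
  refine ⟨ModuleCat.of R (LinearMap.ker p), ModuleCat.of S (LinearMap.range w),
    (LinearMap.range w).subtype, inferInstanceAs (Module.Finite R (LinearMap.ker p)),
    Subtype.val_injective, ?_, ?_, ⟨fun h => absurd h (by omega), fun _ => ?_⟩, ?_, ?_⟩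
  · obtain ⟨e1⟩ := ext1_equiv (K := ↥(LinearMap.ker p)) (P := Fin n → R) (X := K) S U
      (i := i) (p := p) hi hp hex (extV_proj 0)
    obtain ⟨e2⟩ := hE 0
    have hidx : 0 + 1 + j = j + 1 := by omega
    rw [hidx] at e2
    have h4 : LinearMap.range (LinearMap.range w).subtype = LinearMap.range w :=
      Submodule.range_subtype _
    exact ⟨(Submodule.quotEquivOfEq _ _ h4).trans (e1.symm.trans e2)⟩
  · intro k
    obtain ⟨e1⟩ := extU_shift S U k (ModuleCat.of R (LinearMap.ker p))
      (ModuleCat.of R (Fin n → R)) K i p hi hp hex (fun n => extV_proj n)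
    obtain ⟨e2⟩ := hE (k + 1)
    have hidx : k + 1 + 1 + j = k + 1 + (j + 1) := by omega
    rw [hidx] at e2
    exact ⟨e1.symm.trans e2⟩
  · refine ⟨fun x y => Subtype.ext ?_⟩
    have hz : ∀ x : LinearMap.ker (evL (LinearMap.range w).subtype), x.1 = 0 := by
      rintro ⟨x, hx⟩
      apply Subtype.ext
      refine ev_free_inj H n _ fun f => ?_
      exact LinearMap.congr_fun hx (w.rangeRestrict f)
    exact (hz x).trans (hz y).symm
  · exact h0.succ.congr (stage_one_iso H l hls p hp)
  · intro k
    match k with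
    | 0 =>
      refine h1.succ.congr ?_
      obtain ⟨e1⟩ := ext1_equiv (K := L) (P := (Fin n → R) →ₗ[R] U) (X := LinearMap.range w) R U
        (i := a) (p := w.rangeRestrict) ha hw haw (free_dual_acyc H n 0)
      refine ⟨e1.trans (Submodule.quotEquivOfEq _ _ ?_)⟩
      ext Φ
      constructor
      · rintro ⟨Ψ, rfl⟩
        obtain ⟨y, hy⟩ := ev_free_surj H n Ψ
        exact ⟨p y, LinearMap.ext fun b => (hy (a b)).symm⟩
      · rintro ⟨x, rfl⟩
        obtain ⟨y, rfl⟩ := hp x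
        exact ⟨evL LinearMap.id y, rfl⟩
    | k + 1 =>
      refine (h2 k).succ.congr ?_
      exact extU_shift R U k L (ModuleCat.of S ((Fin n → R) →ₗ[R] U))
        (ModuleCat.of S (LinearMap.range w)) a w.rangeRestrict ha hw haw
        (fun m => free_dual_acyc H n m)

lemma stage_final (H : Setup R S U g) [IsNoetherianRing S] [Module.Finite S U]
    (M : ModuleCat.{0} R) (h : Stage S U M g) :
    Module.Finite S (ExtU R S U M g) ∧
    ∀ n, Good R g n (ExtU S R U (ModuleCat.of S (ExtU R S U M g)) n) ↥M := by
  obtain ⟨K, L, l, hK, hl, ⟨e0⟩, hE, h0, h1, h2⟩ := h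
  have hKa : ∀ n, ExtV R K U (n + 1) := by
    intro n
    rw [← extU_iff R S U K n]
    obtain ⟨e⟩ := hE n
    have : Subsingleton (ExtU R S U M (n + 1 + g)) := by
      have hidx : n + 1 + g = (n + g) + 1 := by omega
      rw [hidx, extU_iff]
      exact extV_of_injDim R U g H.idR _ _ (by omega)
    exact e.toEquiv.subsingleton
  have hsurj : Function.Surjective (LinearMap.range l).mkQ := Submodule.mkQ_surjective _
  have hex : Function.Exact l (LinearMap.range l).mkQ := by intro x; simp
  have hfin : Module.Finite S (↥K →ₗ[R] U) := by
    obtain ⟨n, p, hp⟩ := Module.Finite.exists_fin' R K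
    have : Module.Finite S ((Fin n → R) →ₗ[R] U) :=
      Module.Finite.equiv ((Pi.basisFun R (Fin n)).constr S)
    exact Module.Finite.of_injective _ (precompS_inj (S := S) (U := U) hp)
  refine ⟨Module.Finite.equiv e0, fun n => ?_⟩
  suffices hs : Good R g n
      (ExtU S R U (ModuleCat.of S ((↥K →ₗ[R] U) ⧸ LinearMap.range l)) n) ↥M from
    hs.congr (extU_congr R U _ _ e0.symm n)
  match n with
  | 0 =>
    refine h0.congr ?_
    let T : LinearMap.ker (evL l) →ₗ[R] (((↥K →ₗ[R] U) ⧸ LinearMap.range l) →ₗ[S] U) :=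
      { toFun := fun x => (LinearMap.range l).liftQ (evL (R := R) LinearMap.id x.1) (by
          rintro _ ⟨b, rfl⟩
          exact LinearMap.congr_fun x.2 b)
        map_add' := fun x y => Submodule.linearMap_qext _ (LinearMap.ext fun f =>
          map_add f x.1 y.1)
        map_smul' := fun r x => Submodule.linearMap_qext _ (LinearMap.ext fun f =>
          map_smul f r x.1) }
    have hT : ∀ x f, T x (Submodule.Quotient.mk f) = f x.1 := fun x f => rfl
    refine ⟨(LinearEquiv.ofBijective T ⟨?_, ?_⟩).symm⟩
    · rw [injective_iff_map_eq_zero]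
      intro x hx
      apply Subtype.ext
      refine ev_inj H K hKa _ fun f => ?_
      rw [← hT, hx]; rfl
    · intro Φ
      obtain ⟨x, hx⟩ := ev_surj H K hKa (Φ.comp (LinearMap.range l).mkQ)
      refine ⟨⟨x, ?_⟩, ?_⟩
      · rw [LinearMap.mem_ker]
        refine LinearMap.ext fun b => ?_
        have hb : (LinearMap.range l).mkQ (l b) = 0 :=
          (Submodule.Quotient.mk_eq_zero _).2 (LinearMap.mem_range_self l b)
        rw [evL_apply, ← hx, LinearMap.comp_apply, hb, map_zero]
        rfl
      · exact Submodule.linearMap_qext _ (LinearMap.ext fun f => (hx f).symm)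
  | 1 =>
    refine h1.congr ?_
    obtain ⟨e1⟩ := ext1_equiv (K := L) (P := ↥K →ₗ[R] U)
      (X := (↥K →ₗ[R] U) ⧸ LinearMap.range l) R U
      (i := l) (p := (LinearMap.range l).mkQ) hl hsurj hex (acyc_dual H K hKa 0)
    refine ⟨e1.trans (Submodule.quotEquivOfEq _ _ ?_)⟩
    ext Φ
    constructor
    · rintro ⟨Ψ, rfl⟩
      obtain ⟨y, hy⟩ := ev_surj H K hKa Ψ
      exact ⟨y, LinearMap.ext fun b => (hy (l b)).symm⟩
    · rintro ⟨x, rfl⟩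
      exact ⟨evL LinearMap.id x, rfl⟩
  | n + 2 =>
    refine (h2 n).congr ?_
    exact extU_shift R U n L (ModuleCat.of S (↥K →ₗ[R] U))
      (ModuleCat.of S ((↥K →ₗ[R] U) ⧸ LinearMap.range l)) l (LinearMap.range l).mkQ hl hsurj hex
      (fun m => acyc_dual H K hKa m)

lemma one_sided (H : Setup R S U g) [IsNoetherianRing S] [Module.Finite S U]
    (M : ModuleCat.{0} R) (hM : Module.Finite R M) (h : Hmem R S U M g) :
    Module.Finite S (ExtU R S U M g) ∧
    Hmem S R U (ModuleCat.of S (ExtU R S U M g)) g ∧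
    Nonempty (↥M ≃ₗ[R] ExtU S R U (ModuleCat.of S (ExtU R S U M g)) g) := by
  have hst : ∀ j ≤ g, Stage S U M j := by
    intro j
    induction j with
    | zero => exact fun _ => stage_zero M
    | succ j ih => exact fun hj => stage_succ H M j (h.2 j (by omega)) (ih (by omega))
  obtain ⟨hf, hG⟩ := stage_final H M (hst g le_rfl)
  obtain ⟨e⟩ := (hG g).1 rfl
  refine ⟨hf, ⟨⟨fun j hj => (hG j).2 (by omega), fun hv => ?_⟩, fun i hi => (hG i).2 hi⟩,
    ⟨e.symm⟩⟩
  have hMs : Subsingleton M := by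
    have : Subsingleton (ExtU S R U (ModuleCat.of S (ExtU R S U M g)) g) := hv
    exact e.symm.toEquiv.subsingleton
  refine h.1.2 ?_
  change Subsingleton _
  cases hg : g with
  | zero =>
    have hs : Subsingleton (↥M →ₗ[R] U) :=
      ⟨fun f f' => LinearMap.ext fun x => by rw [Subsingleton.elim x 0, map_zero, map_zero]⟩
    exact hs
  | succ k =>
    rw [extU_iff]
    have : Module.Free R ↥M := Module.Free.of_subsingleton R ↥M
    have : Module.Projective R ↥M := Module.Projective.of_free
    exact extV_proj k

end Stages


section Statement

variable (Λ Γ : Type) [Ring Λ] [Ring Γ]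
  [IsNoetherianRing Λ] [IsNoetherianRing Λᵐᵒᵖ]
  [IsNoetherianRing Γ] [IsNoetherianRing Γᵐᵒᵖ]
variable (U : Type) [AddCommGroup U] [Module Λ U] [Module Γᵐᵒᵖ U]
  [SMulCommClass Λ Γᵐᵒᵖ U] [SMulCommClass Γᵐᵒᵖ Λ U]
  [Module.Finite Λ U] [Module.Finite Γᵐᵒᵖ U]

/-- **Corollary 4.3.** Let `U` be a Gorenstein bimodule with
`r.id_Γ(U) = l.id_Λ(U) = g`. Then `M ↦ Ext^g_Λ(M,U)` gives a duality between
`H_g(mod Λ)` and `H_g(mod Γᵒᵖ)`. -/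
theorem ext_duality_H (g : ℕ)
    (hfb : FaithfullyBalanced Λ Γ U) (hso : SelfOrthogonal Λ Γ U)
    (hgor : ∀ k, LeftGorenstein Λ Γ U k ∧ RightGorenstein Λ Γ U k)
    (hrid : injDim Γᵐᵒᵖ (ModuleCat.of Γᵐᵒᵖ U) = (g : ℕ∞))
    (hlid : injDim Λ (ModuleCat.of Λ U) = (g : ℕ∞)) :
    (∀ M : ModuleCat.{0} Λ, Module.Finite Λ ↥M → Hmem Λ Γᵐᵒᵖ U M g →
      Module.Finite Γᵐᵒᵖ (ExtU Λ Γᵐᵒᵖ U M g) ∧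
      Hmem Γᵐᵒᵖ Λ U (ModuleCat.of Γᵐᵒᵖ (ExtU Λ Γᵐᵒᵖ U M g)) g ∧
      Nonempty (↥M ≃ₗ[Λ] ExtU Γᵐᵒᵖ Λ U (ModuleCat.of Γᵐᵒᵖ (ExtU Λ Γᵐᵒᵖ U M g)) g)) ∧
    (∀ N : ModuleCat.{0} Γᵐᵒᵖ, Module.Finite Γᵐᵒᵖ ↥N → Hmem Γᵐᵒᵖ Λ U N g →
      Module.Finite Λ (ExtU Γᵐᵒᵖ Λ U N g) ∧
      Hmem Λ Γᵐᵒᵖ U (ModuleCat.of Λ (ExtU Γᵐᵒᵖ Λ U N g)) g ∧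
      Nonempty (↥N ≃ₗ[Γᵐᵒᵖ] ExtU Λ Γᵐᵒᵖ U (ModuleCat.of Λ (ExtU Γᵐᵒᵖ Λ U N g)) g)) := by
  have H1 : Setup Λ Γᵐᵒᵖ U g :=
    { faith := fun r hr => hfb.1.1 (LinearMap.ext fun u => (hr u).trans (zero_smul Λ u).symm)
      bal := fun φ => by
        obtain ⟨r, hr⟩ := hfb.1.2 φ
        exact ⟨r, fun u => (LinearMap.congr_fun hr u).symm⟩
      orth := fun n =>
        (extU_iff Γᵐᵒᵖ Λ U (ModuleCat.of Γᵐᵒᵖ U) n).1 (hso.2 (n + 1) (by omega))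
      idS := hrid
      idR := hlid }
  have H2 : Setup Γᵐᵒᵖ Λ U g :=
    { faith := fun r hr => hfb.2.1 (LinearMap.ext fun u => (hr u).trans (zero_smul Γᵐᵒᵖ u).symm)
      bal := fun φ => by
        obtain ⟨r, hr⟩ := hfb.2.2 φ
        exact ⟨r, fun u => (LinearMap.congr_fun hr u).symm⟩
      orth := fun n =>
        (extU_iff Λ Γᵐᵒᵖ U (ModuleCat.of Λ U) n).1 (hso.1 (n + 1) (by omega))
      idS := hlid
      idR := hrid }
  exact ⟨fun M hM h => one_sided H1 M hM h, fun N hN h => one_sided H2 N hN h⟩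

end Statement

end GorPaper
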